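/- arXiv:1901.04036 — 2 statements merged into one kernel-verified Lean document; each statement's English description precedes it below -/
import Mathlib

section
/- Let l, w be positive integers and i ∈ {1,2}, and let Σ be a mincut of the hammock network H^{(i)}_{l,w}. If M, N, P, Q ∈ V^{(i)}_{l,w} are four points such that MN, NP, PQ, QM are (distinct) edges of E^{(i)}_{l,w} forming a square (i.e., M, N, P, Q are the four lattice points neighboring a common point in the four diagonal directions), then the number of these four sides belonging to Σ is either 0 or 2. -/
open scoped Classical

/-- Parity predicate: kind 1 = even points (x+y even), kind 2 = odd points. -/
def HammockPar (i : ℕ) (p : ℤ × ℤ) : Prop :=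
  if i = 1 then Even (p.1 + p.2) else Odd (p.1 + p.2)

/-- The set 𝒱_{l,w} of lattice points of the rectangle [0,l] × [0,w]. -/
def HammockVAll (l w : ℕ) : Set (ℤ × ℤ) :=
  {p | 0 ≤ p.1 ∧ p.1 ≤ (l : ℤ) ∧ 0 ≤ p.2 ∧ p.2 ≤ (w : ℤ)}

/-- The vertex set V^{(i)}_{l,w} of the hammock network of kind `i`. -/
def HammockV (i l w : ℕ) : Set (ℤ × ℤ) :=
  {p | p ∈ HammockVAll l w ∧ HammockPar i p}

/-- The set 𝓔_{l,w} of all diagonal unit edges inside the rectangle. -/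
def HammockEAll (l w : ℕ) : Set (Sym2 (ℤ × ℤ)) :=
  {e | ∃ a b : ℤ × ℤ, e = s(a, b) ∧ a ∈ HammockVAll l w ∧ b ∈ HammockVAll l w ∧
      |a.1 - b.1| = 1 ∧ |a.2 - b.2| = 1}

/-- The edge set E^{(i)}_{l,w} of the hammock network of kind `i`. -/
def HammockE (i l w : ℕ) : Set (Sym2 (ℤ × ℤ)) :=
  {e | e ∈ HammockEAll l w ∧ ∀ p ∈ e, HammockPar i p}

/-- The allowed steps of an X-path. -/
def XStep : Set (ℤ × ℤ) := {(1, 1), (-1, 1), (1, -1), (-1, -1)}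

/-- An X-path: a finite sequence of pairwise distinct lattice points, each obtained
from the previous one by a step in `XStep`. -/
def IsXPath (vs : List (ℤ × ℤ)) : Prop :=
  vs.Nodup ∧ vs.Chain' (fun a b => b - a ∈ XStep)

/-- The list of edges of an X-path. -/
def xEdges (vs : List (ℤ × ℤ)) : List (Sym2 (ℤ × ℤ)) :=
  (vs.zip vs.tail).map fun q => s(q.1, q.2)

/-- A two-terminal network on the diagonal lattice: an edge set together with
a set of source nodes and a set of terminus nodes. -/
structure HNetwork where
  edges : Set (Sym2 (ℤ × ℤ))
  src : Set (ℤ × ℤ)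
  tgt : Set (ℤ × ℤ)

/-- `P` is a pathset: `P ⊆ edges` and `P` contains all edges of some X-path
joining a source node to a terminus node. -/
def HNetwork.IsPathset (N : HNetwork) (P : Set (Sym2 (ℤ × ℤ))) : Prop :=
  P ⊆ N.edges ∧ ∃ (vs : List (ℤ × ℤ)) (h : vs ≠ []),
    IsXPath vs ∧ vs.head h ∈ N.src ∧ vs.getLast h ∈ N.tgt ∧ ∀ e ∈ xEdges vs, e ∈ P

/-- `C` is a cutset: removing `C` leaves no pathset. -/
def HNetwork.IsCutset (N : HNetwork) (C : Set (Sym2 (ℤ × ℤ))) : Prop :=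
  C ⊆ N.edges ∧ ¬ N.IsPathset (N.edges \ C)

/-- A minpath: a pathset no proper subset of which is a pathset. -/
def HNetwork.IsMinpath (N : HNetwork) (P : Set (Sym2 (ℤ × ℤ))) : Prop :=
  N.IsPathset P ∧ ∀ Q, Q ⊂ P → ¬ N.IsPathset Q

/-- A mincut: a cutset no proper subset of which is a cutset. -/
def HNetwork.IsMincut (N : HNetwork) (C : Set (Sym2 (ℤ × ℤ))) : Prop :=
  N.IsCutset C ∧ ∀ D, D ⊂ C → ¬ N.IsCutset D

/-- The hammock network H^{(i)}_{l,w}: sources are its vertices with x = 0,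
terminals its vertices with x = l. -/
def hammock (i l w : ℕ) : HNetwork where
  edges := HammockE i l w
  src := {p | p ∈ HammockV i l w ∧ p.1 = 0}
  tgt := {p | p ∈ HammockV i l w ∧ p.1 = (l : ℤ)}

/-- The dual network H̄^{(i)}_{l,w}: vertex set 𝒱 − V^{(i)}, edge set 𝓔 − E^{(i)},
sources the points with y = 0, terminals the points with y = w. -/
def hammockDual (i l w : ℕ) : HNetwork where
  edges := HammockEAll l w \ HammockE i l w
  src := {p | p ∈ HammockVAll l w \ HammockV i l w ∧ p.2 = 0}
  tgt := {p | p ∈ HammockVAll l w \ HammockV i l w ∧ p.2 = (w : ℤ)}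

/-- The complementary edge: ē of e = {(x,y),(x+1,y±1)} is {(x+1,y),(x,y±1)}. -/
def complEdge : Sym2 (ℤ × ℤ) → Sym2 (ℤ × ℤ) :=
  Sym2.lift ⟨fun a b => s((a.1, b.2), (b.1, a.2)), fun _ _ => Sym2.eq_swap⟩

/-- The other kind: 2/1 = 2 and 2/2 = 1. -/
def otherKind (i : ℕ) : ℕ := if i = 1 then 2 else 1

/-- The edge set E^{(i)}_{l,w} as a finite set. -/
noncomputable def hammockEFinset (i l w : ℕ) : Finset (Sym2 (ℤ × ℤ)) :=
  ((Finset.Icc (0 : ℤ) l) ×ˢ (Finset.Icc (0 : ℤ) w)).sym2.filter (· ∈ HammockE i l w)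

/-- The reliability polynomial h^{(i)}_{l,w}(p) = Σ_P p^{|P|} (1-p)^{lw-|P|},
summing over all pathsets P of H^{(i)}_{l,w}. -/
noncomputable def hammockRel (i l w : ℕ) (p : ℝ) : ℝ :=
  ∑ P ∈ (hammockEFinset i l w).powerset.filter (fun P : Finset (Sym2 (ℤ × ℤ)) => (hammock i l w).IsPathset ↑P),
    p ^ P.card * (1 - p) ^ (l * w - P.card)

abbrev hG (T : Set (Sym2 (ℤ × ℤ))) : SimpleGraph (ℤ × ℤ) := SimpleGraph.fromEdgeSet T

theorem edge_facts {i l w : ℕ} {a b : ℤ × ℤ} (h : s(a, b) ∈ HammockE i l w) :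
    a ∈ HammockV i l w ∧ b ∈ HammockV i l w ∧ (b.1 = a.1 + 1 ∨ b.1 = a.1 - 1) ∧
      (b.2 = a.2 + 1 ∨ b.2 = a.2 - 1) := by
  obtain ⟨⟨x, y, hxy, hx, hy, h1, h2⟩, hp⟩ := h
  have ha := hp a (by simp)
  have hb := hp b (by simp)
  rw [abs_eq (by norm_num)] at h1 h2
  rcases Sym2.eq_iff.1 hxy with ⟨rfl, rfl⟩ | ⟨rfl, rfl⟩
  · exact ⟨⟨hx, ha⟩, ⟨hy, hb⟩, by omega, by omega⟩
  · exact ⟨⟨hy, ha⟩, ⟨hx, hb⟩, by omega, by omega⟩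

theorem chain_zip {α : Type*} {R : α → α → Prop} : ∀ (vs : List α), vs.IsChain R →
    ∀ p ∈ vs.zip vs.tail, R p.1 p.2
  | [], _, p, hp => by simp at hp
  | [a], _, p, hp => by simp at hp
  | a :: b :: t, h, p, hp => by
    rw [List.isChain_cons_cons] at h
    simp only [List.tail_cons, List.zip_cons_cons, List.mem_cons] at hp
    rcases hp with rfl | hp
    · exact h.1
    · exact chain_zip (b :: t) h.2 p (by simpa using hp)

theorem list_reach {T : Set (Sym2 (ℤ × ℤ))} : ∀ (vs : List (ℤ × ℤ)) (h : vs ≠ []),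
    (∀ e ∈ xEdges vs, e ∈ T) → (hG T).Reachable (vs.head h) (vs.getLast h)
  | [], h, _ => absurd rfl h
  | [a], _, _ => by simp
  | a :: b :: t, _, he => by
    have h1 := list_reach (b :: t) (by simp) (fun e hh => he e (by
      simp only [xEdges, List.tail_cons, List.zip_cons_cons, List.map_cons, List.mem_cons] at hh ⊢
      exact Or.inr hh))
    have h2 : s(a, b) ∈ T := he _ (by simp [xEdges])
    have h3 : (hG T).Reachable a b := by
      by_cases hab : a = b
      · subst hab; exact SimpleGraph.Reachable.refl _
      · exact SimpleGraph.Adj.reachable (by simp [hG, h2, hab])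
    simpa using h3.trans h1

theorem pathset_iff {i l w : ℕ} {T : Set (Sym2 (ℤ × ℤ))} (hT : T ⊆ HammockE i l w) :
    (hammock i l w).IsPathset T ↔
      ∃ s ∈ (hammock i l w).src, ∃ t ∈ (hammock i l w).tgt, (hG T).Reachable s t := by
  constructor
  · rintro ⟨-, vs, h, -, hs, ht, he⟩
    exact ⟨_, hs, _, ht, list_reach vs h he⟩
  · rintro ⟨s, hs, t, ht, ⟨p⟩⟩
    have hch := (p.toPath : (hG T).Walk s t).isChain_adj_support
    refine ⟨hT, (p.toPath : (hG T).Walk s t).support, by simp, ⟨p.toPath.2.support_nodup, ?_⟩,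
      by simpa using hs, by simpa using ht, ?_⟩
    · refine List.IsChain.imp ?_ hch
      intro a b hab
      have h1 : s(a, b) ∈ T := ((SimpleGraph.fromEdgeSet_adj T).1 hab).1
      obtain ⟨-, -, hx, hy⟩ := edge_facts (hT h1)
      obtain ⟨a1, a2⟩ := a
      obtain ⟨b1, b2⟩ := b
      simp only at hx hy
      simp only [XStep, Prod.mk_sub_mk, Set.mem_insert_iff, Set.mem_singleton_iff, Prod.mk.injEq]
      omega
    · intro e he
      simp only [xEdges, List.mem_map] at he
      obtain ⟨q, hq, rfl⟩ := he
      have := chain_zip _ hch q hq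
      exact ((SimpleGraph.fromEdgeSet_adj T).1 this).1

theorem reach_insert {T T' : Set (Sym2 (ℤ × ℤ))} {a b : ℤ × ℤ}
    (hT : ∀ e ∈ T', e ∈ T ∨ e = s(a, b)) {s t : ℤ × ℤ} (p : (hG T').Walk s t) :
    (hG T).Reachable s t ∨ ((hG T).Reachable s a ∧ (hG T).Reachable b t) ∨
      ((hG T).Reachable s b ∧ (hG T).Reachable a t) := by
  induction p with
  | nil => exact Or.inl (SimpleGraph.Reachable.refl _)
  | @cons u v t h p ih =>
    obtain ⟨h1, h2⟩ := (SimpleGraph.fromEdgeSet_adj T').1 h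
    rcases hT _ h1 with h3 | h3
    · have h4 : (hG T).Reachable u v := SimpleGraph.Adj.reachable (by simp [hG, h3, h2])
      rcases ih with ih | ⟨i1, i2⟩ | ⟨i1, i2⟩
      · exact Or.inl (h4.trans ih)
      · exact Or.inr (Or.inl ⟨h4.trans i1, i2⟩)
      · exact Or.inr (Or.inr ⟨h4.trans i1, i2⟩)
    · have r : ∀ x, (hG T).Reachable x x := fun x => SimpleGraph.Reachable.refl x
      rcases Sym2.eq_iff.1 h3 with ⟨rfl, rfl⟩ | ⟨rfl, rfl⟩
      · rcases ih with ih | ⟨i1, i2⟩ | ⟨i1, i2⟩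
        · exact Or.inr (Or.inl ⟨r _, ih⟩)
        · exact Or.inr (Or.inl ⟨r _, i2⟩)
        · exact Or.inl i2
      · rcases ih with ih | ⟨i1, i2⟩ | ⟨i1, i2⟩
        · exact Or.inr (Or.inr ⟨r _, ih⟩)
        · exact Or.inl i2
        · exact Or.inr (Or.inr ⟨r _, i2⟩)

/-- Crossing of the vertical ray above `a` (slightly to its left), for a rightward
edge with right end `v`. -/
noncomputable def rayC (a v : ℤ × ℤ) : ℤ := if v.1 = a.1 ∧ a.2 < v.2 then 1 else 0

/-- `g` is a winding function of a curve in `X` ending in `a`, continued by the ray above `a`. -/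
def WInv (i l w : ℕ) (X : Set (ℤ × ℤ)) (c : ℤ × ℤ) (z : ℤ) (a : ℤ × ℤ) (g : ℤ × ℤ → ℤ) : Prop :=
  (∀ u v, u ∈ HammockV i l w → v ∈ HammockV i l w → u ∉ X → v ∉ X → v.1 = u.1 + 1 →
    (v.2 = u.2 + 1 ∨ v.2 = u.2 - 1) → g v - g u = rayC a v) ∧
  (g (c.1 + 1, c.2) - g (c.1 - 1, c.2) = rayC a c + rayC a (c.1 + 1, c.2)) ∧
  (∀ v, v.1 = z → g v = 0)

theorem par_mod {i : ℕ} {p q : ℤ × ℤ} (hp : HammockPar i p) (hq : HammockPar i q) :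
    (p.1 + p.2) % 2 = (q.1 + q.2) % 2 := by
  unfold HammockPar at hp hq
  split_ifs at hp hq
  · rw [Int.even_iff] at hp hq; omega
  · rw [Int.odd_iff] at hp hq; omega

theorem ray_rel {a a' v u : ℤ × ℤ} (hx : a'.1 = a.1 + 1) (hy : a'.2 = a.2 + 1 ∨ a'.2 = a.2 - 1)
    (hu : u.1 + 1 = v.1) (huv : v.2 = u.2 + 1 ∨ v.2 = u.2 - 1)
    (hp : (a.1 + a.2) % 2 = (u.1 + u.2) % 2)
    (hua : u ≠ a) (hva : v ≠ a') :
    rayC a' v = rayC a u := by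
  have h1 : ¬ (u.1 = a.1 ∧ u.2 = a.2) := fun h => hua (Prod.ext h.1 h.2)
  have h2 : ¬ (v.1 = a'.1 ∧ v.2 = a'.2) := fun h => hva (Prod.ext h.1 h.2)
  unfold rayC
  split_ifs <;> omega

theorem ray_relQ {a a' c : ℤ × ℤ} (hx : a'.1 = a.1 + 1) (hy : a'.2 = a.2 + 1 ∨ a'.2 = a.2 - 1)
    (hp : (a.1 + a.2) % 2 = (c.1 + 1 + c.2) % 2)
    (hua : (c.1 - 1, c.2) ≠ a) (hva : (c.1 + 1, c.2) ≠ a') :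
    rayC a' c = rayC a (c.1 - 1, c.2) ∧ rayC a' (c.1 + 1, c.2) = rayC a c := by
  have h1 : ¬ (c.1 - 1 = a.1 ∧ c.2 = a.2) := fun h => hua (Prod.ext h.1 h.2)
  have h2 : ¬ (c.1 + 1 = a'.1 ∧ c.2 = a'.2) := fun h => hva (Prod.ext h.1 h.2)
  unfold rayC
  constructor <;> simp only <;> split_ifs <;> omega

theorem winv_step {i l w : ℕ} {X : Set (ℤ × ℤ)} {c : ℤ × ℤ} {z : ℤ} {a a' : ℤ × ℤ}
    {g : ℤ × ℤ → ℤ} (haV : a ∈ HammockV i l w) (haV' : a' ∈ HammockV i l w)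
    (ha : a ∈ X) (ha' : a' ∈ X) (hz : ∀ v ∈ X, v.1 ≠ z)
    (hx : a'.1 = a.1 + 1 ∨ a'.1 = a.1 - 1) (hy : a'.2 = a.2 + 1 ∨ a'.2 = a.2 - 1)
    (hNV : (c.1 + 1, c.2) ∈ HammockV i l w)
    (hN : (c.1 + 1, c.2) ∉ X) (hQ : (c.1 - 1, c.2) ∉ X)
    (h : WInv i l w X c z a g) : ∃ g', WInv i l w X c z a' g' := by
  have ne : ∀ {u v : ℤ × ℤ}, u ∉ X → v ∈ X → u ≠ v := fun h1 h2 h3 => h1 (h3 ▸ h2)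
  obtain ⟨h1, h2, h3⟩ := h
  rcases hx with hx | hx
  · refine ⟨fun v => g v - rayC a v, ?_, ?_, ?_⟩
    · intro u v hu hv hu' hv' e1 e2
      have r := ray_rel hx hy (u := u) (v := v) (by omega) e2 (par_mod haV.2 hu.2)
        (ne hu' ha) (ne hv' ha')
      have := h1 u v hu hv hu' hv' e1 e2
      simp only; linarith
    · have r := ray_relQ hx hy (c := c) (par_mod haV.2 hNV.2) (ne hQ ha) (ne hN ha')
      simp only; linarith [r.1, r.2]
    · intro v hv
      have : rayC a v = 0 := by
        unfold rayC; rw [if_neg]; rintro ⟨e, -⟩; exact hz a ha (by omega)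
      simp only [this, h3 v hv, sub_zero]
  · refine ⟨fun v => g v + rayC a' v, ?_, ?_, ?_⟩
    · intro u v hu hv hu' hv' e1 e2
      have r := ray_rel (a := a') (a' := a) (by omega) (by omega) (u := u) (v := v) (by omega) e2
        (par_mod haV'.2 hu.2) (ne hu' ha') (ne hv' ha)
      have := h1 u v hu hv hu' hv' e1 e2
      simp only; linarith
    · have r := ray_relQ (a := a') (a' := a) (by omega) (by omega) (c := c)
        (par_mod haV'.2 hNV.2) (ne hQ ha') (ne hN ha)
      simp only; linarith [r.1, r.2]
    · intro v hv
      have : rayC a' v = 0 := by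
        unfold rayC; rw [if_neg]; rintro ⟨e, -⟩; exact hz a' ha' (by omega)
      simp only [this, h3 v hv, add_zero]

/-- The set of vertices reachable from `Z` in `T`. -/
def reachS (T : Set (Sym2 (ℤ × ℤ))) (Z : Set (ℤ × ℤ)) : Set (ℤ × ℤ) :=
  {v | ∃ s ∈ Z, (hG T).Reachable s v}

theorem reachS_ind {T : Set (Sym2 (ℤ × ℤ))} {Z : Set (ℤ × ℤ)} {p : ℤ × ℤ → Prop}
    (h0 : ∀ s ∈ Z, p s)
    (h1 : ∀ u v, u ∈ reachS T Z → v ∈ reachS T Z → s(u, v) ∈ T → p u → p v) :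
    ∀ v ∈ reachS T Z, p v := by
  rintro v ⟨s, hs, hr⟩
  rw [SimpleGraph.reachable_iff_reflTransGen] at hr
  induction hr with
  | refl => exact h0 s hs
  | @tail b c hb hc ih =>
    rw [← SimpleGraph.reachable_iff_reflTransGen] at hb
    exact h1 b c ⟨s, hs, hb⟩ ⟨s, hs, hb.trans (SimpleGraph.Adj.reachable hc)⟩
      ((SimpleGraph.fromEdgeSet_adj T).1 hc).1 ih

theorem reachS_step {T : Set (Sym2 (ℤ × ℤ))} {Z : Set (ℤ × ℤ)} {u v : ℤ × ℤ}
    (hu : u ∈ reachS T Z) (h : s(u, v) ∈ T) : v ∈ reachS T Z := by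
  by_cases huv : u = v
  · exact huv ▸ hu
  · obtain ⟨s, hs, hr⟩ := hu
    exact ⟨s, hs, hr.trans (SimpleGraph.Adj.reachable (by simp [hG, h, huv]))⟩

/-- The topological core: the two pairs of opposite corners of a square cannot both be
joined to opposite sides. -/
theorem no_cross {i l w : ℕ} {T : Set (Sym2 (ℤ × ℤ))} (hT : T ⊆ HammockE i l w)
    {X0 Y0 : Set (ℤ × ℤ)} (hX0 : X0 ⊆ HammockV i l w) (hY0 : Y0 ⊆ HammockV i l w) {z x0 : ℤ}
    (hx0 : x0 = 0 ∨ x0 = l) (hXx : ∀ v ∈ X0, v.1 = x0) (hYz : ∀ v ∈ Y0, v.1 = z)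
    (hxz : z ≠ x0)
    (hz : ∀ v ∈ reachS T X0, v.1 ≠ z)
    (hd : ∀ v ∈ reachS T Y0, v ∉ reachS T X0) {c : ℤ × ℤ}
    (hNV : (c.1 + 1, c.2) ∈ HammockV i l w) (hQV : (c.1 - 1, c.2) ∈ HammockV i l w)
    (hM : (c.1, c.2 + 1) ∈ reachS T X0) (hP : (c.1, c.2 - 1) ∈ reachS T X0)
    (hN : (c.1 + 1, c.2) ∈ reachS T Y0) (hQ : (c.1 - 1, c.2) ∈ reachS T Y0) : False := by
  have hV : ∀ {Z : Set (ℤ × ℤ)}, Z ⊆ HammockV i l w → ∀ v ∈ reachS T Z, v ∈ HammockV i l w := by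
    intro Z hZ
    exact reachS_ind (fun s hs => hZ hs) (fun u v _ _ h _ => (edge_facts (hT h)).2.1)
  have key : ∀ a ∈ reachS T X0, ∃ g, WInv i l w (reachS T X0) c z a g := by
    refine reachS_ind ?_ ?_
    · intro s hs
      have e := hXx s hs
      have q1 : 0 ≤ c.1 - 1 := hQV.1.1
      have q2 : c.1 + 1 ≤ l := hNV.1.2.1
      rcases hx0 with h0 | h0
      · refine ⟨fun _ => 0, ?_, ?_, fun _ _ => rfl⟩
        · intro u v hu hv _ _ e1 e2
          have : 0 ≤ u.1 := hu.1.1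
          unfold rayC; rw [if_neg (by omega)]; rfl
        · unfold rayC; simp only; split_ifs <;> omega
      · refine ⟨rayC s, ?_, ?_, ?_⟩
        · intro u v hu hv _ _ e1 e2
          have : v.1 ≤ l := hv.1.2.1
          unfold rayC; split_ifs <;> omega
        · unfold rayC; simp only; split_ifs <;> omega
        · intro v hv
          unfold rayC; rw [if_neg (by omega)]
    · rintro u v hu hv h ⟨g, hg⟩
      obtain ⟨f1, f2, f3, f4⟩ := edge_facts (hT h)
      exact winv_step f1 f2 hu hv hz f3 f4 hNV (hd _ hN) (hd _ hQ) hg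
  obtain ⟨g, g1, g2, g3⟩ := key _ hM
  obtain ⟨g', g1', g2', g3'⟩ := key _ hP
  have hMV := hV hX0 _ hM
  have par : ∀ v ∈ HammockV i l w, v ∉ reachS T X0 →
      rayC (c.1, c.2 + 1) v = rayC (c.1, c.2 - 1) v := by
    intro v hv hv'
    have p := par_mod hv.2 hMV.2
    have n1 : ¬ (v.1 = c.1 ∧ v.2 = c.2 + 1) := fun h => hv' ((Prod.ext h.1 h.2 : v = (c.1, c.2 + 1)) ▸ hM)
    simp only at p
    unfold rayC; simp only; split_ifs <;> omega
  have cst : ∀ v ∈ reachS T Y0, g v = g' v := by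
    refine reachS_ind ?_ ?_
    · intro s hs
      rw [g3 s (hYz s hs), g3' s (hYz s hs)]
    · intro u v hu hv h e
      obtain ⟨f1, f2, f3, f4⟩ := edge_facts (hT h)
      rcases f3 with f3 | f3
      · have := g1 u v f1 f2 (hd _ hu) (hd _ hv) f3 f4
        have := g1' u v f1 f2 (hd _ hu) (hd _ hv) f3 f4
        have := par v f2 (hd _ hv)
        linarith
      · have := g1 v u f2 f1 (hd _ hv) (hd _ hu) (by omega) (by omega)
        have := g1' v u f2 f1 (hd _ hv) (hd _ hu) (by omega) (by omega)
        have := par u f1 (hd _ hu)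
        linarith
  have e1 := cst _ hN
  have e2 := cst _ hQ
  have e3 := par _ hNV (hd _ hN)
  have e4 : rayC (c.1, c.2 + 1) c = 0 := by unfold rayC; rw [if_neg]; rintro ⟨-, h⟩; simp only at h; omega
  have e5 : rayC (c.1, c.2 - 1) c = 1 := by unfold rayC; rw [if_pos]; exact ⟨rfl, by simp only; omega⟩
  linarith

theorem mincut_edge {i l w : ℕ} {S : Set (Sym2 (ℤ × ℤ))} (hS : (hammock i l w).IsMincut S)
    {a b : ℤ × ℤ} (h : s(a, b) ∈ S) :
    (a ∈ reachS (HammockE i l w \ S) (hammock i l w).src ∧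
      b ∈ reachS (HammockE i l w \ S) (hammock i l w).tgt) ∨
    (b ∈ reachS (HammockE i l w \ S) (hammock i l w).src ∧
      a ∈ reachS (HammockE i l w \ S) (hammock i l w).tgt) := by
  have h1 := hS.2 (S \ {s(a, b)}) ⟨Set.sdiff_subset, fun hh => (hh h).2 rfl⟩
  have h2 : (hammock i l w).IsPathset (HammockE i l w \ (S \ {s(a, b)})) := by
    by_contra hc
    exact h1 ⟨Set.sdiff_subset.trans hS.1.1, hc⟩
  have h0 : ¬ (hammock i l w).IsPathset (HammockE i l w \ S) := hS.1.2
  rw [pathset_iff Set.sdiff_subset] at h0 h2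
  obtain ⟨s, hs, t, ht, ⟨p⟩⟩ := h2
  rcases reach_insert (T := HammockE i l w \ S) (a := a) (b := b) (by
    rintro e ⟨he1, he2⟩
    by_cases hh : e = s(a, b)
    · exact Or.inr hh
    · exact Or.inl ⟨he1, fun h3 => he2 ⟨h3, hh⟩⟩) p with r | ⟨r1, r2⟩ | ⟨r1, r2⟩
  · exact absurd ⟨s, hs, t, ht, r⟩ h0
  · exact Or.inl ⟨⟨s, hs, r1⟩, ⟨t, ht, r2.symm⟩⟩
  · exact Or.inr ⟨⟨s, hs, r1⟩, ⟨t, ht, r2.symm⟩⟩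

/-- If Σ is a mincut of H^{(i)}_{l,w} and M, N, P, Q are the four
lattice points surrounding a common point c, so that MN, NP, PQ, QM are edges of
E^{(i)}_{l,w} forming a square, then either none or exactly two of these four
sides belong to Σ. -/
theorem mincut_square_zero_or_two (l w : ℕ) (hl : 0 < l) (hw : 0 < w)
    (i : ℕ) (hi : i = 1 ∨ i = 2) (S : Set (Sym2 (ℤ × ℤ)))
    (hS : (hammock i l w).IsMincut S) (c M N P Q : ℤ × ℤ)
    (hM : M = c + (0, 1)) (hN : N = c + (1, 0)) (hP : P = c + (0, -1)) (hQ : Q = c + (-1, 0))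
    (hMN : s(M, N) ∈ HammockE i l w) (hNP : s(N, P) ∈ HammockE i l w)
    (hPQ : s(P, Q) ∈ HammockE i l w) (hQM : s(Q, M) ∈ HammockE i l w) :
    (({s(M, N), s(N, P), s(P, Q), s(Q, M)} : Finset (Sym2 (ℤ × ℤ))).filter
        (· ∈ S)).card = 0 ∨
    (({s(M, N), s(N, P), s(P, Q), s(Q, M)} : Finset (Sym2 (ℤ × ℤ))).filter
        (· ∈ S)).card = 2 := by
  set T := HammockE i l w \ S with hTdef
  have hT : T ⊆ HammockE i l w := Set.sdiff_subset
  set A := reachS T (hammock i l w).src with hA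
  set B := reachS T (hammock i l w).tgt with hB
  have h0 : ¬ (hammock i l w).IsPathset T := hS.1.2
  rw [pathset_iff hT] at h0
  have hd : ∀ v, v ∈ A → v ∈ B → False := by
    rintro v ⟨s, hs, r⟩ ⟨t, ht, r'⟩
    exact h0 ⟨s, hs, t, ht, r.trans r'.symm⟩
  have hV : ∀ {Z : Set (ℤ × ℤ)}, Z ⊆ HammockV i l w → ∀ v ∈ reachS T Z, v ∈ HammockV i l w := by
    intro Z hZ
    exact reachS_ind (fun s hs => hZ hs) (fun u v _ _ h _ => (edge_facts (hT h)).2.1)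
  have hs0 : (hammock i l w).src ⊆ HammockV i l w := fun v hv => hv.1
  have ht0 : (hammock i l w).tgt ⊆ HammockV i l w := fun v hv => hv.1
  have hAl : ∀ v ∈ A, v.1 ≠ (l : ℤ) := fun v hv e =>
    hd v hv ⟨v, ⟨hV hs0 v hv, e⟩, SimpleGraph.Reachable.refl _⟩
  have hBl : ∀ v ∈ B, v.1 ≠ 0 := fun v hv e =>
    hd v ⟨v, ⟨hV ht0 v hv, e⟩, SimpleGraph.Reachable.refl _⟩ hv
  have hin : ∀ {a b : ℤ × ℤ}, s(a, b) ∈ S → (a ∈ A ∧ b ∈ B) ∨ (b ∈ A ∧ a ∈ B) :=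
    fun h => mincut_edge hS h
  have hout : ∀ {a b : ℤ × ℤ}, s(a, b) ∈ HammockE i l w → s(a, b) ∉ S →
      ((a ∈ A ↔ b ∈ A) ∧ (a ∈ B ↔ b ∈ B)) := by
    intro a b h1 h2
    have h3 : s(a, b) ∈ T := ⟨h1, h2⟩
    have h4 : s(b, a) ∈ T := Sym2.eq_swap ▸ h3
    exact ⟨⟨fun h => reachS_step h h3, fun h => reachS_step h h4⟩,
      ⟨fun h => reachS_step h h3, fun h => reachS_step h h4⟩⟩
  have eM : M = (c.1, c.2 + 1) := by rw [hM]; ext <;> simp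
  have eN : N = (c.1 + 1, c.2) := by rw [hN]; ext <;> simp
  have eP : P = (c.1, c.2 - 1) := by rw [hP]; ext <;> simp [sub_eq_add_neg]
  have eQ : Q = (c.1 - 1, c.2) := by rw [hQ]; ext <;> simp [sub_eq_add_neg]
  have hNV : N ∈ HammockV i l w := (edge_facts hNP).1
  have hQV : Q ∈ HammockV i l w := (edge_facts hQM).1
  have hlz : (l : ℤ) ≠ 0 := by omega
  have c1 : ¬ (M ∈ A ∧ P ∈ A ∧ N ∈ B ∧ Q ∈ B) := by
    rintro ⟨m, p, n, q⟩
    rw [eN] at n hNV; rw [eQ] at q hQV; rw [eM] at m; rw [eP] at p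
    exact no_cross hT hs0 ht0 (Or.inl rfl) (fun v hv => hv.2) (fun v hv => hv.2) hlz hAl
      (fun v h1 h2 => hd v h2 h1) hNV hQV m p n q
  have c2 : ¬ (M ∈ B ∧ P ∈ B ∧ N ∈ A ∧ Q ∈ A) := by
    rintro ⟨m, p, n, q⟩
    rw [eN] at n hNV; rw [eQ] at q hQV; rw [eM] at m; rw [eP] at p
    exact no_cross hT ht0 hs0 (Or.inr rfl) (fun v hv => hv.2) (fun v hv => hv.2) hlz.symm hBl
      (fun v h1 h2 => hd v h1 h2) hNV hQV m p n q
  have d1 := hd M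
  have d2 := hd N
  have d3 := hd P
  have d4 := hd Q
  have i1 := @hin M N
  have i2 := @hin N P
  have i3 := @hin P Q
  have i4 := @hin Q M
  have o1 := hout hMN
  have o2 := hout hNP
  have o3 := hout hPQ
  have o4 := hout hQM
  have n1 : s(M, N) ≠ s(N, P) := by rw [eM, eN, eP]; simp [Sym2.eq_iff]; omega
  have n2 : s(M, N) ≠ s(P, Q) := by rw [eM, eN, eP, eQ]; simp [Sym2.eq_iff]; omega
  have n3 : s(M, N) ≠ s(Q, M) := by rw [eM, eN, eQ]; simp [Sym2.eq_iff]; omega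
  have n4 : s(N, P) ≠ s(P, Q) := by rw [eN, eP, eQ]; simp [Sym2.eq_iff]; omega
  have n5 : s(N, P) ≠ s(Q, M) := by rw [eM, eN, eP, eQ]; simp [Sym2.eq_iff]; omega
  have n6 : s(P, Q) ≠ s(Q, M) := by rw [eM, eP, eQ]; simp [Sym2.eq_iff]; omega
  clear hin hout hd hAl hBl hV
  clear_value A B
  by_cases k1 : s(M, N) ∈ S <;> by_cases k2 : s(N, P) ∈ S <;> by_cases k3 : s(P, Q) ∈ S <;>
    by_cases k4 : s(Q, M) ∈ S <;>
    first
    | (left; simp only [Finset.filter_insert, Finset.filter_singleton, k1, k2, k3, k4, if_true, if_false]; rfl)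
    | (right; simp only [Finset.filter_insert, Finset.filter_singleton, k1, k2, k3, k4, if_true, if_false]
       simp [n1, n2, n3, n4, n5, n6, Finset.card_insert_of_notMem]; done)
    | (exfalso; simp only [k1, k2, k3, k4, not_true_eq_false, not_false_eq_true, forall_const, false_imp_iff, true_imp_iff] at i1 i2 i3 i4 o1 o2 o3 o4
       clear n1 n2 n3 n4 n5 n6 k1 k2 k3 k4 hA hB; grind)
end

section
/- Let n = 2k+1 be an odd positive integer. Then the reliability polynomial of the square hammock network of dimensions (n,n) satisfies h_{n,n}(p) + h_{n,n}(1−p) = 1 for all p ∈ [0,1]; in particular h_{n,n}(1/2) = 1/2, i.e., the point (1/2, 1/2) is a center of symmetry of the graph of h_{n,n}. -/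
open scoped Classical

namespace HS

def Adj (P : Set (Sym2 (ℤ × ℤ))) (a b : ℤ × ℤ) : Prop := s(a, b) ∈ P

lemma par_iff (i : ℕ) (hi : i = 1 ∨ i = 2) (p : ℤ × ℤ) :
    HammockPar i p ↔ (p.1 + p.2 + i) % 2 = 1 := by
  unfold HammockPar
  rcases hi with rfl | rfl
  · simp only [if_true, Int.even_iff]; push_cast; omega
  · simp only [Int.odd_iff]; push_cast; simp

lemma abs_one (x : ℤ) : |x| = 1 ↔ (x = 1 ∨ x = -1) := by
  rw [abs_eq (by norm_num)]

def EE (i n : ℕ) (a b : ℤ × ℤ) : Prop :=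
  (0 ≤ a.1 ∧ a.1 ≤ n ∧ 0 ≤ a.2 ∧ a.2 ≤ n) ∧ (0 ≤ b.1 ∧ b.1 ≤ n ∧ 0 ≤ b.2 ∧ b.2 ≤ n) ∧
  (a.1 - b.1 = 1 ∨ a.1 - b.1 = -1) ∧ (a.2 - b.2 = 1 ∨ a.2 - b.2 = -1) ∧
  (a.1 + a.2 + i) % 2 = 1

lemma memE (i n : ℕ) (hi : i = 1 ∨ i = 2) (a b : ℤ × ℤ) :
    s(a, b) ∈ HammockE i n n ↔ EE i n a b := by
  unfold HammockE HammockEAll EE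
  simp only [Set.mem_setOf_eq, Sym2.mem_iff, HammockVAll, abs_one, par_iff i hi]
  constructor
  · rintro ⟨⟨c, d, h, h1, h2, h3, h4⟩, h5⟩
    have ha := h5 a (Or.inl rfl)
    rcases Sym2.eq_iff.1 h with ⟨rfl, rfl⟩ | ⟨rfl, rfl⟩
    · exact ⟨h1, h2, h3, h4, ha⟩
    · exact ⟨h2, h1, by omega, by omega, ha⟩
  · rintro ⟨h1, h2, h3, h4, h5⟩
    refine ⟨⟨a, b, rfl, h1, h2, h3, h4⟩, ?_⟩
    rintro p (rfl | rfl)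
    · exact h5
    · omega

lemma xEdges_iff (P : Set (Sym2 (ℤ × ℤ))) (vs : List (ℤ × ℤ)) :
    (∀ e ∈ xEdges vs, e ∈ P) ↔ vs.IsChain (Adj P) := by
  induction vs with
  | nil => simp [xEdges]
  | cons a t ih =>
    cases t with
    | nil => simp [xEdges]
    | cons b t =>
      rw [List.isChain_cons_cons, ← ih]
      simp [xEdges, Adj]

lemma exists_nodup (P : Set (Sym2 (ℤ × ℤ))) (hP : ∀ a, s(a, a) ∉ P) (a b : ℤ × ℤ)
    (h : Relation.ReflTransGen (Adj P) a b) :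
    ∃ (vs : List (ℤ × ℤ)) (hne : vs ≠ []), vs.Nodup ∧ vs.IsChain (Adj P) ∧
      vs.head hne = a ∧ vs.getLast hne = b := by
  let G : SimpleGraph (ℤ × ℤ) :=
    { Adj := Adj P
      symm := ⟨fun x y h => by unfold Adj at *; rwa [Sym2.eq_swap]⟩
      loopless := ⟨fun x h => hP x h⟩ }
  have hr : G.Reachable a b := by
    rw [SimpleGraph.reachable_iff_reflTransGen]; exact h
  obtain ⟨w⟩ := hr
  refine ⟨w.toPath.1.support, w.toPath.1.support_ne_nil, w.toPath.2.support_nodup,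
    w.toPath.1.isChain_adj_support, ?_, ?_⟩ <;> simp

lemma pathset_iff (i n : ℕ) (hi : i = 1 ∨ i = 2) (P : Set (Sym2 (ℤ × ℤ)))
    (hP : P ⊆ HammockE i n n) :
    (hammock i n n).IsPathset P ↔ ∃ a b, a ∈ HammockV i n n ∧ a.1 = 0 ∧ b ∈ HammockV i n n ∧ b.1 = n ∧
      Relation.ReflTransGen (Adj P) a b := by
  constructor
  · rintro ⟨-, vs, hne, -, h1, h2, h3⟩
    rw [xEdges_iff] at h3
    refine ⟨_, _, h1.1, h1.2, h2.1, h2.2, ?_⟩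
    exact List.relationReflTransGen_of_exists_isChain vs h3 hne
  · rintro ⟨a, b, ha, ha', hb, hb', h⟩
    obtain ⟨vs, hne, h1, h2, rfl, rfl⟩ := exists_nodup P (by
      intro a h
      have := (memE i n hi a a).1 (hP h)
      unfold EE at this; omega) a b h
    refine ⟨hP, vs, hne, ⟨h1, ?_⟩, ⟨ha, ha'⟩, ⟨hb, hb'⟩, (xEdges_iff P vs).2 h2⟩
    refine h2.imp ?_
    intro x y hxy
    have := (memE i n hi x y).1 (hP hxy)
    unfold EE at this
    obtain ⟨-, -, h3, h4, -⟩ := this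
    simp only [XStep, Set.mem_insert_iff, Set.mem_singleton_iff, Prod.ext_iff, Prod.fst_sub, Prod.snd_sub]
    omega

/-- rotation of the complementary edge -/
def tau (n : ℕ) : Sym2 (ℤ × ℤ) → Sym2 (ℤ × ℤ) :=
  Sym2.lift ⟨fun a b => s((b.2, n - a.1), (a.2, n - b.1)), fun _ _ => Sym2.eq_swap⟩

lemma tau_mk (n : ℕ) (a b : ℤ × ℤ) :
    tau n s(a, b) = s((b.2, n - a.1), (a.2, n - b.1)) := rfl

lemma tau4 (n : ℕ) (e) : tau n (tau n (tau n (tau n e))) = e := by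
  induction e with | _ a b => simp [tau_mk]

lemma tau_inj (n : ℕ) : Function.Injective (tau n) := by
  intro x y h
  rw [← tau4 n x, h, tau4]

lemma tau_mem (i n k : ℕ) (hn : n = 2 * k + 1) (hi : i = 1 ∨ i = 2) (e) (h : e ∈ HammockE i n n) :
    tau n e ∈ HammockE i n n := by
  induction e with | _ a b =>
  rw [tau_mk, memE i n hi]
  rw [memE i n hi] at h
  unfold EE at *
  simp only
  omega

lemma mem_EF (i n : ℕ) (hi : i = 1 ∨ i = 2) (e) : e ∈ hammockEFinset i n n ↔ e ∈ HammockE i n n := by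
  unfold hammockEFinset
  rw [Finset.mem_filter]
  refine ⟨fun h => h.2, fun h => ⟨?_, h⟩⟩
  induction e with | _ a b =>
  rw [memE i n hi] at h
  unfold EE at h
  simp only [Finset.mk_mem_sym2_iff, Finset.mem_product, Finset.mem_Icc]
  omega

lemma card_EF (i n : ℕ) (hi : i = 1 ∨ i = 2) : (hammockEFinset i n n).card = n * n := by
  have : (Finset.Ico (0:ℤ) n ×ˢ Finset.Ico (0:ℤ) n).card = n * n := by simp
  rw [← this]
  symm
  refine Finset.card_bij (fun c _ => if (c.1 + c.2 + i) % 2 = 1 then s(c, (c.1 + 1, c.2 + 1))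
    else s((c.1 + 1, c.2), (c.1, c.2 + 1))) ?_ ?_ ?_
  · intro c hc
    simp only [Finset.mem_product, Finset.mem_Ico] at hc
    rw [mem_EF i n hi]
    split_ifs <;> (rw [memE i n hi]; unfold EE; simp only; omega)
  · intro c hc d hd h
    ext <;> split_ifs at h <;> rw [Sym2.eq_iff] at h <;> simp only [Prod.ext_iff] at h <;> omega
  · intro e he
    rw [mem_EF i n hi] at he
    induction e with | _ a b =>
    rw [memE i n hi] at he
    unfold EE at he
    refine ⟨(min a.1 b.1, min a.2 b.2), ?_, ?_⟩
    · simp only [Finset.mem_product, Finset.mem_Ico]; omega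
    · simp only
      split_ifs <;> rw [Sym2.eq_iff] <;> simp only [Prod.ext_iff] <;> omega

/-- cohomological computation -/
lemma cell_sum (n : ℕ) (r : ℕ → ℕ → ZMod 2)
    (hcell : ∀ x < n, ∀ y < n, (r x y + r (x+1) (y+1)) * (r (x+1) y + r x (y+1)) = 0)
    (hb : ∀ x < n, (r x 0 + 1) * (r (x+1) 0 + 1) = 0)
    (hl : ∀ y < n, (r 0 y + 1) * (r 0 (y+1) + 1) = 0)
    (ht : ∀ x < n, r x n * r (x+1) n = 0)
    (hr : ∀ y < n, r n y * r n (y+1) = 0) : r n 0 + r 0 n = 0 := by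
  have two : (2 : ZMod 2) = 0 := by decide
  have key : ∀ f : ℕ → ZMod 2, ∑ x ∈ Finset.range n, (f (x+1) + f x) = f n + f 0 := by
    intro f
    have := Finset.sum_range_sub f n
    simpa only [CharTwo.sub_eq_add] using this
  have h0 : ∑ x ∈ Finset.range n, ∑ y ∈ Finset.range n,
      ((r x (y+1) * r (x+1) (y+1) + r x y * r (x+1) y) + (r (x+1) y * r (x+1) (y+1) + r x y * r x (y+1))) = 0 := by
    refine Finset.sum_eq_zero fun x hx => Finset.sum_eq_zero fun y hy => ?_
    rw [← hcell x (Finset.mem_range.1 hx) y (Finset.mem_range.1 hy)]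
    ring
  simp only [Finset.sum_add_distrib (f := fun y => (_ + _ : ZMod 2))] at h0
  rw [Finset.sum_add_distrib] at h0
  rw [Finset.sum_comm (f := fun x y => r (x+1) y * r (x+1) (y+1) + r x y * r x (y+1))] at h0
  rw [Finset.sum_congr rfl (fun x _ => key (fun y => r x y * r (x+1) y)),
    Finset.sum_congr rfl (fun y _ => key (fun x => r x y * r x (y+1)))] at h0
  have e1 : ∑ x ∈ Finset.range n, (r x n * r (x+1) n + r x 0 * r (x+1) 0) =
      ∑ x ∈ Finset.range n, ((r (x+1) 0 + r x 0) + 1) := by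
    refine Finset.sum_congr rfl fun x hx => ?_
    rw [ht x (Finset.mem_range.1 hx)]
    linear_combination hb x (Finset.mem_range.1 hx) - (r (x+1) 0 + r x 0 + 1) * two
  have e2 : ∑ y ∈ Finset.range n, (r n y * r n (y+1) + r 0 y * r 0 (y+1)) =
      ∑ y ∈ Finset.range n, ((r 0 (y+1) + r 0 y) + 1) := by
    refine Finset.sum_congr rfl fun x hx => ?_
    rw [hr x (Finset.mem_range.1 hx)]
    linear_combination hl x (Finset.mem_range.1 hx) - (r 0 (x+1) + r 0 x + 1) * two
  rw [e1, e2, Finset.sum_add_distrib (f := fun x => r (x+1) 0 + r x 0),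
    Finset.sum_add_distrib (f := fun x => r 0 (x+1) + r 0 x),
    key (fun x => r x 0), key (fun y => r 0 y)] at h0
  linear_combination h0 - (r 0 0 + ∑ i ∈ Finset.range n, 1) * two

/-- relation between dual steps and closed edges -/
def dualSet (i n : ℕ) (P : Set (Sym2 (ℤ × ℤ))) : Set (Sym2 (ℤ × ℤ)) :=
  {e | ∃ x, x ∈ HammockE i n n \ P ∧ tau n x = e}

lemma exists_path (i n k : ℕ) (hn : n = 2 * k + 1) (hi : i = 1 ∨ i = 2) (P : Set (Sym2 (ℤ × ℤ)))
    (hP : P ⊆ HammockE i n n)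
    (h1 : ¬ ∃ a b, a ∈ HammockV i n n ∧ a.1 = 0 ∧ b ∈ HammockV i n n ∧ b.1 = n ∧
      Relation.ReflTransGen (Adj P) a b)
    (h2 : ¬ ∃ a b, a ∈ HammockV i n n ∧ a.1 = 0 ∧ b ∈ HammockV i n n ∧ b.1 = n ∧
      Relation.ReflTransGen (Adj (dualSet i n P)) a b) : False := by
  let R (Q : Set (Sym2 (ℤ × ℤ))) (b : ℤ × ℤ) : Prop :=
    ∃ a, a ∈ HammockV i n n ∧ a.1 = 0 ∧ Relation.ReflTransGen (Adj Q) a b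
  have memV : ∀ a : ℤ × ℤ, a ∈ HammockV i n n ↔
      ((0 ≤ a.1 ∧ a.1 ≤ n ∧ 0 ≤ a.2 ∧ a.2 ≤ n) ∧ (a.1 + a.2 + i) % 2 = 1) := by
    intro a
    simp only [HammockV, HammockVAll, Set.mem_setOf_eq, par_iff i hi]
  have hRstep : ∀ Q a b, s(a, b) ∈ Q → (R Q a ↔ R Q b) := by
    intro Q a b h
    constructor
    · rintro ⟨c, hc, hc', hr⟩
      exact ⟨c, hc, hc', hr.tail h⟩
    · rintro ⟨c, hc, hc', hr⟩
      exact ⟨c, hc, hc', hr.tail (by unfold Adj; rwa [Sym2.eq_swap])⟩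
  have hR0 : ∀ Q (a : ℤ × ℤ), a ∈ HammockV i n n → a.1 = 0 → R Q a :=
    fun Q a ha h => ⟨a, ha, h, .refl⟩
  have hRP : ∀ (a : ℤ × ℤ), a ∈ HammockV i n n → a.1 = n → ¬ R P a := by
    rintro a ha h ⟨c, hc, hc', hr⟩
    exact h1 ⟨c, a, hc, hc', ha, h, hr⟩
  have hRQ : ∀ (a : ℤ × ℤ), a ∈ HammockV i n n → a.1 = n → ¬ R (dualSet i n P) a := by
    rintro a ha h ⟨c, hc, hc', hr⟩
    exact h2 ⟨c, a, hc, hc', ha, h, hr⟩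
  let T (x y : ℕ) : Prop := if (x + y + i) % 2 = 1 then R P (x, y)
    else R (dualSet i n P) (y, n - x)
  let r (x y : ℕ) : ZMod 2 := if T x y then 1 else 0
  have rT : ∀ x y, T x y → r x y = 1 := fun x y h => if_pos h
  have rF : ∀ x y, ¬ T x y → r x y = 0 := fun x y h => if_neg h
  have c2 : (1 + 1 : ZMod 2) = 0 := by decide
  have rE : ∀ x y x' y', (T x y ↔ T x' y') → r x y + r x' y' = 0 := by
    intro x y x' y' h
    by_cases hT : T x y
    · rw [rT _ _ hT, rT _ _ (h.1 hT), c2]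
    · rw [rF _ _ hT, rF _ _ (fun h' => hT (h.2 h')), add_zero]
  -- boundary values
  have bL : ∀ y ≤ n, (0 + y + i) % 2 = 1 → T 0 y := by
    intro y hy h
    simp only [T, if_pos h]
    exact hR0 _ _ ((memV _).2 (by simp only; omega)) (by simp)
  have bR : ∀ y ≤ n, (n + y + i) % 2 = 1 → ¬ T n y := by
    intro y hy h
    simp only [T, if_pos h]
    exact hRP _ ((memV _).2 (by simp only; omega)) (by simp)
  have bB : ∀ x ≤ n, ¬ (x + 0 + i) % 2 = 1 → T x 0 := by
    intro y hy h
    simp only [T, if_neg h]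
    exact hR0 _ _ ((memV _).2 (by simp only; omega)) (by simp)
  have bT : ∀ x ≤ n, ¬ (x + n + i) % 2 = 1 → ¬ T x n := by
    intro y hy h
    simp only [T, if_neg h]
    exact hRQ _ ((memV _).2 (by simp only; omega)) (by simp)
  have hfin := cell_sum n r ?_ ?_ ?_ ?_ ?_
  · by_cases h : (n + i) % 2 = 1
    · rw [rF n 0 (bR 0 (by omega) (by omega)), rT 0 n (bL n le_rfl (by omega))] at hfin
      revert hfin; decide
    · rw [rT n 0 (bB n le_rfl (by omega)), rF 0 n (bT 0 (by omega) (by omega))] at hfin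
      revert hfin; decide
  · intro x hx y hy
    by_cases h : (x + y + i) % 2 = 1
    · have he : s(((x:ℤ), (y:ℤ)), ((x:ℤ)+1, (y:ℤ)+1)) ∈ HammockE i n n := by
        rw [memE i n hi]; unfold EE; simp only; omega
      by_cases hp : s(((x:ℤ), (y:ℤ)), ((x:ℤ)+1, (y:ℤ)+1)) ∈ P
      · have := hRstep _ _ _ hp
        rw [rE x y (x+1) (y+1), zero_mul]
        simp only [T]
        rw [if_pos h, if_pos (by omega)]
        push_cast; exact this
      · have hq : tau n _ ∈ dualSet i n P := ⟨_, ⟨he, hp⟩, rfl⟩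
        rw [tau_mk] at hq
        have := hRstep _ _ _ hq
        rw [rE (x+1) y x (y+1), mul_zero]
        simp only [T]
        rw [if_neg (by omega), if_neg (by omega)]
        push_cast; exact this.symm
    · have he : s(((x:ℤ)+1, (y:ℤ)), ((x:ℤ), (y:ℤ)+1)) ∈ HammockE i n n := by
        rw [memE i n hi]; unfold EE; simp only; omega
      by_cases hp : s(((x:ℤ)+1, (y:ℤ)), ((x:ℤ), (y:ℤ)+1)) ∈ P
      · have := hRstep _ _ _ hp
        rw [rE (x+1) y x (y+1), mul_zero]
        simp only [T]
        rw [if_pos (by omega), if_pos (by omega)]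
        push_cast; exact this
      · have hq : tau n _ ∈ dualSet i n P := ⟨_, ⟨he, hp⟩, rfl⟩
        rw [tau_mk] at hq
        have := hRstep _ _ _ hq
        rw [rE x y (x+1) (y+1), zero_mul]
        simp only [T]
        rw [if_neg h, if_neg (by omega)]
        push_cast; exact this.symm
  · intro x hx
    by_cases h : (x + 0 + i) % 2 = 1
    · rw [rT (x+1) 0 (bB _ (by omega) (by omega)), c2, mul_zero]
    · rw [rT x 0 (bB _ (by omega) h), c2, zero_mul]
  · intro y hy
    by_cases h : (0 + y + i) % 2 = 1
    · rw [rT 0 y (bL _ (by omega) h), c2, zero_mul]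
    · rw [rT 0 (y+1) (bL _ (by omega) (by omega)), c2, mul_zero]
  · intro x hx
    by_cases h : (x + n + i) % 2 = 1
    · rw [rF (x+1) n (bT _ (by omega) (by omega)), mul_zero]
    · rw [rF x n (bT _ (by omega) h), zero_mul]
  · intro y hy
    by_cases h : (n + y + i) % 2 = 1
    · rw [rF n y (bR _ (by omega) h), zero_mul]
    · rw [rF n (y+1) (bR _ (by omega) (by omega)), mul_zero]

lemma dual_step (i n : ℕ) (hi : i = 1 ∨ i = 2) (P : Set (Sym2 (ℤ × ℤ))) (w w' : ℤ × ℤ)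
    (h : s(w, w') ∈ dualSet i n P) : ∃ a b, EE i n a b ∧ s(a, b) ∉ P ∧ b.2 = a.2 + 1 ∧
      ((w = (b.2, n - a.1) ∧ w' = (a.2, n - b.1)) ∨ (w' = (b.2, n - a.1) ∧ w = (a.2, n - b.1))) := by
  obtain ⟨e, ⟨he, hp⟩, h⟩ := h
  induction e with | _ a b =>
  rw [tau_mk, Sym2.eq_iff] at h
  by_cases hab : b.2 = a.2 + 1
  · refine ⟨a, b, (memE i n hi a b).1 he, hp, hab, ?_⟩
    rcases h with ⟨h, h'⟩ | ⟨h, h'⟩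
    · exact Or.inl ⟨h.symm, h'.symm⟩
    · exact Or.inr ⟨h.symm, h'.symm⟩
  · rw [Sym2.eq_swap] at he hp
    have hE := (memE i n hi b a).1 he
    refine ⟨b, a, hE, hp, by unfold EE at hE; omega, ?_⟩
    rcases h with ⟨h, h'⟩ | ⟨h, h'⟩
    · exact Or.inr ⟨h'.symm, h.symm⟩
    · exact Or.inl ⟨h'.symm, h.symm⟩

def ind (p : Prop) [Decidable p] : ZMod 2 := if p then 1 else 0

lemma invariant (i n : ℕ) (hi : i = 1 ∨ i = 2) (P : Set (Sym2 (ℤ × ℤ)))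
    (w0 w : ℤ × ℤ) (h0 : w0.1 = 0)
    (h : Relation.ReflTransGen (Adj (dualSet i n P)) w0 w) :
    ∃ F : ℤ × ℤ → ZMod 2,
      (∀ v v' : ℤ × ℤ, EE i n v v' → s(v, v') ∈ P → v'.2 = v.2 + 1 →
        F v' + F v + ind (w.1 = v'.2 ∧ n - w.2 < v'.1) = 0) ∧
      (∀ y, F (0, y) = 0) ∧
      (∀ y : ℤ, 0 ≤ y → (n + y + i) % 2 = 1 → F (n, y) = ind (y < w.1)) ∧
      (∀ x, F (x, n) = 0) := by
  induction h with
  | refl =>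
    refine ⟨fun _ => 0, ?_, ?_, ?_, ?_⟩
    · intro v v' hv _ h
      have : ¬ (w0.1 = v'.2 ∧ n - w0.2 < v'.1) := by unfold EE at hv; omega
      simp [ind, this]
    · simp
    · intro y hy _
      have : ¬ (y < w0.1) := by omega
      simp [ind, this]
    · simp
  | @tail u u' _ hs ih =>
    obtain ⟨F, f1, f2, f3, f4⟩ := ih
    obtain ⟨a, b, hE, hp, hab, hu⟩ := dual_step i n hi P u u' hs
    have two : (2 : ZMod 2) = 0 := by decide
    unfold EE at hE
    refine ⟨fun v => F v + ind (a.2 = v.2 ∧ b.1 < v.1), ?_, ?_, ?_, ?_⟩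
    · intro v v' hv hvp h
      have g := f1 v v' hv hvp h
      have hne : ¬ (a.1 = v.1 ∧ a.2 = v.2 ∧ b.1 = v'.1) := by
        rintro ⟨e1, e2, e3⟩
        have e : a = v := Prod.ext e1 e2
        have e' : b = v' := Prod.ext e3 (by omega)
        exact hp (by rw [e, e']; exact hvp)
      unfold EE at hv
      have key : ind (a.2 = v'.2 ∧ b.1 < v'.1) + ind (a.2 = v.2 ∧ b.1 < v.1) +
          ind (u.1 = v'.2 ∧ n - u.2 < v'.1) + ind (u'.1 = v'.2 ∧ n - u'.2 < v'.1) = 0 := by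
        have k1 : (a.2 = v.2 ∧ b.1 < v.1) ↔ (b.2 = v'.2 ∧ a.1 < v'.1) := by omega
        rcases hu with ⟨rfl, rfl⟩ | ⟨rfl, rfl⟩
        · simp only [sub_sub_cancel, ind, k1]
          split_ifs <;> decide
        · simp only [sub_sub_cancel, ind, k1]
          split_ifs <;> decide
      linear_combination key + g - ind (u.1 = v'.2 ∧ n - u.2 < v'.1) * two
    · intro y
      have : ¬ (a.2 = y ∧ b.1 < 0) := by omega
      simp [ind, this, f2]
    · intro y hy hpar
      simp only
      rw [f3 y hy hpar]
      have k : (a.2 = y ∧ b.1 < n) ↔ a.2 = y := by omega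
      rcases hu with ⟨rfl, rfl⟩ | ⟨rfl, rfl⟩ <;> simp only [ind, k] <;> split_ifs <;>
        first | omega | rfl | decide
    · intro x
      have : ¬ (a.2 = n ∧ b.1 < x) := by omega
      simp [ind, this, f4]

lemma not_both (i n k : ℕ) (hn : n = 2 * k + 1) (hi : i = 1 ∨ i = 2) (P : Set (Sym2 (ℤ × ℤ)))
    (hP : P ⊆ HammockE i n n)
    (h1 : ∃ a b, a ∈ HammockV i n n ∧ a.1 = 0 ∧ b ∈ HammockV i n n ∧ b.1 = n ∧
      Relation.ReflTransGen (Adj P) a b)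
    (h2 : ∃ a b, a ∈ HammockV i n n ∧ a.1 = 0 ∧ b ∈ HammockV i n n ∧ b.1 = n ∧
      Relation.ReflTransGen (Adj (dualSet i n P)) a b) : False := by
  obtain ⟨a, b, ha, ha0, hb, hbn, hr⟩ := h1
  obtain ⟨c, d, hc, hc0, hd, hdn, hr'⟩ := h2
  obtain ⟨F, f1, f2, f3, f4⟩ := invariant i n hi P c d hc0 hr'
  simp only [HammockV, HammockVAll, Set.mem_setOf_eq, par_iff i hi] at ha hb hc hd
  have two : (2 : ZMod 2) = 0 := by decide
  let G : ℤ × ℤ → ZMod 2 := fun v => F v + ind (d.1 = v.2 ∧ n - d.2 < v.1)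
  have up : ∀ v v' : ℤ × ℤ, EE i n v v' → s(v, v') ∈ P → v'.2 = v.2 + 1 → G v = G v' := by
    intro v v' hE hp h
    have g := f1 v v' hE hp h
    have : ¬ (d.1 = v.2 ∧ n - d.2 < v.1) := by unfold EE at hE; omega
    simp only [G, ind, if_neg this] at g ⊢
    linear_combination F v * two - g
  have st : ∀ v v', Adj P v v' → G v = G v' := by
    intro v v' h
    have hE := (memE i n hi v v').1 (hP h)
    by_cases hv : v'.2 = v.2 + 1
    · exact up v v' hE h hv
    · have h' : s(v', v) ∈ P := by rw [Sym2.eq_swap]; exact h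
      have hE' := (memE i n hi v' v).1 (hP h')
      exact (up v' v hE' h' (by unfold EE at hE; omega)).symm
  have const : G a = G b := by
    clear hb hbn
    induction hr with
    | refl => rfl
    | tail _ hs ih => exact ih.trans (st _ _ hs)
  have Ga : G a = 0 := by
    have e : a = (0, a.2) := Prod.ext ha0 rfl
    have : ¬ (d.1 = a.2 ∧ n - d.2 < a.1) := by omega
    simp only [G, ind, if_neg this]
    rw [e, f2, add_zero]
  have Gb : G b = 1 := by
    have e : b = (↑n, b.2) := Prod.ext hbn rfl
    have hF := f3 b.2 (by omega) (by omega)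
    rw [← e] at hF
    simp only [G, hF, ind]
    split_ifs <;> first | omega | rfl | decide
  rw [Ga, Gb] at const
  revert const; decide

lemma duality (i n k : ℕ) (hn : n = 2 * k + 1) (hi : i = 1 ∨ i = 2) (P : Set (Sym2 (ℤ × ℤ)))
    (hP : P ⊆ HammockE i n n) :
    (hammock i n n).IsPathset (dualSet i n P) ↔ ¬ (hammock i n n).IsPathset P := by
  have hD : dualSet i n P ⊆ HammockE i n n := by
    rintro _ ⟨e, he, rfl⟩
    exact tau_mem i n k hn hi e he.1
  rw [pathset_iff i n hi _ hP, pathset_iff i n hi _ hD]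
  constructor
  · intro h h'; exact not_both i n k hn hi P hP h' h
  · intro h; by_contra h'; exact exists_path i n k hn hi P hP h h'

lemma sym (i n k : ℕ) (hn : n = 2 * k + 1) (hi : i = 1 ∨ i = 2) (p : ℝ) :
    hammockRel i n n p + hammockRel i n n (1 - p) = 1 := by
  set E := hammockEFinset i n n with hE
  have hcard : E.card = n * n := card_EF i n hi
  have hsub : ∀ P ⊆ E, (↑P : Set (Sym2 (ℤ × ℤ))) ⊆ HammockE i n n := fun P hP e he =>
    (mem_EF i n hi e).1 (hP he)
  have himg : E.image (tau n) = E := by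
    apply Finset.eq_of_subset_of_card_le
    · intro e he
      obtain ⟨e, hm, rfl⟩ := Finset.mem_image.1 he
      exact (mem_EF i n hi _).2 (tau_mem i n k hn hi e ((mem_EF i n hi _).1 hm))
    · rw [Finset.card_image_of_injective _ (tau_inj n)]
  have hco : ∀ P, (↑((E \ P).image (tau n)) : Set (Sym2 (ℤ × ℤ))) = dualSet i n ↑P := by
    intro P
    ext e
    simp [dualSet, hE, mem_EF i n hi]
  have h2 : hammockRel i n n (1 - p) =
      ∑ P ∈ E.powerset.filter (fun P : Finset (Sym2 (ℤ × ℤ)) => ¬ (hammock i n n).IsPathset ↑P),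
        p ^ P.card * (1 - p) ^ (n * n - P.card) := by
    unfold hammockRel
    symm
    refine Finset.sum_bij (fun P _ => (E \ P).image (tau n)) ?_ ?_ ?_ ?_
    · intro P hP
      rw [Finset.mem_filter, Finset.mem_powerset] at hP ⊢
      refine ⟨?_, ?_⟩
      · exact (Finset.image_subset_image Finset.sdiff_subset).trans himg.le
      · rw [hco, duality i n k hn hi _ (hsub P hP.1)]
        exact hP.2
    · intro P hP Q hQ h
      rw [Finset.mem_filter, Finset.mem_powerset] at hP hQ
      have := Finset.image_injective (tau_inj n) h
      rw [← Finset.sdiff_sdiff_eq_self hP.1, this, Finset.sdiff_sdiff_eq_self hQ.1]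
    · intro Q hQ
      rw [Finset.mem_filter, Finset.mem_powerset] at hQ
      obtain ⟨S, hS, rfl⟩ := Finset.subset_image_iff.1 (himg.symm ▸ hQ.1 : Q ⊆ E.image (tau n))
      have hS' : S ⊆ E := by exact_mod_cast hS
      refine ⟨E \ S, ?_, ?_⟩
      · rw [Finset.mem_filter, Finset.mem_powerset]
        refine ⟨Finset.sdiff_subset, ?_⟩
        rw [← duality i n k hn hi _ (hsub _ Finset.sdiff_subset), ← hco,
          Finset.sdiff_sdiff_eq_self hS']
        exact hQ.2
      · simp only [Finset.sdiff_sdiff_eq_self hS']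
    · intro P hP
      rw [Finset.mem_filter, Finset.mem_powerset] at hP
      have hc := Finset.card_le_card hP.1
      rw [Finset.card_image_of_injective _ (tau_inj n), Finset.card_sdiff_of_subset hP.1, hcard]
      rw [hcard] at hc
      rw [Nat.sub_sub_self hc, sub_sub_cancel, mul_comm]
  rw [h2]
  unfold hammockRel
  rw [Finset.sum_filter_add_sum_filter_not, ← hcard, Finset.sum_pow_mul_eq_add_pow]
  simp

end HS

/-- For odd n, the reliability polynomial h_{n,n} (of either kind,
the two kinds coinciding for odd dimensions) satisfies h_{n,n}(p) + h_{n,n}(1−p) = 1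
on [0,1]; in particular h_{n,n}(1/2) = 1/2. -/
theorem hammockRel_square_symmetry (n k : ℕ) (hn : n = 2 * k + 1) :
    ∀ i : ℕ, i = 1 ∨ i = 2 →
      (∀ p : ℝ, 0 ≤ p → p ≤ 1 →
        hammockRel i n n p + hammockRel i n n (1 - p) = 1) ∧
      hammockRel i n n (1 / 2) = 1 / 2 := by
  intro i hi
  refine ⟨fun p _ _ => HS.sym i n k hn hi p, ?_⟩
  have h := HS.sym i n k hn hi (1 / 2)
  have e : (1 - 1 / 2 : ℝ) = 1 / 2 := by norm_num
  rw [e] at h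
  linarith
end
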